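/- arXiv:2012.15447 — 2 statements merged into one kernel-verified Lean document; each statement's English description precedes it below -/
import Mathlib

section
/- Let I = B(M,N) ⊆ S = K[x_1, …, x_n] with Borel generators M = x_a·x_b and N = x_c·x_d, c < a ≤ b < d, let G₁ = { T_u T_v − T_{u'} T_{v'} : u·v = u'·v' and u, v ≻_rlex v' } marked at T_u T_v, and let μ be a monomial of S such that the fiber graph Γ_μ(I) with respect to G₁ is nonempty. If Γ_μ(I) has a vertex which is a product of variables T_m with all m ∈ B_M, then every sink of Γ_μ(I) is of the form T_{M'}·Z where Z is a sink of Γ_{μ/M'}(I). Otherwise, every sink of Γ_μ(I) is of the form T_{N'}·Z where Z is a sink of Γ_{μ/N'}(I). -/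
/-- A marked binomial: the difference of two monomials (given by exponent vectors),
with `head` chosen as the marked term. -/
structure MarkedBinomial (V : Type*) where
  head : V →₀ ℕ
  tail : V →₀ ℕ

/-- The polynomial associated to a marked binomial. -/
noncomputable def MarkedBinomial.toPoly {V : Type*} (K : Type*) [Field K]
    (g : MarkedBinomial V) : MvPolynomial V K :=
  MvPolynomial.monomial g.head 1 - MvPolynomial.monomial g.tail 1

/-- Transport a marked binomial along a map of variables. -/
noncomputable def MarkedBinomial.map {V W : Type*} (f : V → W) (g : MarkedBinomial V) :
    MarkedBinomial W :=
  ⟨Finsupp.mapDomain f g.head, Finsupp.mapDomain f g.tail⟩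

/-- A monomial order on the exponent vectors `V →₀ ℕ`: a strict total order, compatible
with addition, for which `1` (the zero exponent vector) is the smallest monomial. -/
structure MonomialOrd (V : Type*) where
  gt : (V →₀ ℕ) → (V →₀ ℕ) → Prop
  irrefl : ∀ m, ¬ gt m m
  trans : ∀ {m₁ m₂ m₃}, gt m₁ m₂ → gt m₂ m₃ → gt m₁ m₃
  total : ∀ m₁ m₂, m₁ ≠ m₂ → gt m₁ m₂ ∨ gt m₂ m₁
  add_right : ∀ {m₁ m₂} (m₃), gt m₁ m₂ → gt (m₁ + m₃) (m₂ + m₃)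
  gt_zero : ∀ m, m ≠ 0 → gt m 0

/-- `m` is the initial (leading) exponent of `f` with respect to the strict order `gt`. -/
def IsInitialTerm {V K : Type*} [Field K] (gt : (V →₀ ℕ) → (V →₀ ℕ) → Prop)
    (f : MvPolynomial V K) (m : V →₀ ℕ) : Prop :=
  m ∈ f.support ∧ ∀ m' ∈ f.support, m' ≠ m → gt m m'

/-- A set `G` of marked binomials is a Gröbner basis of the ideal `J` with respect to the
order `gt`, with the marked terms as initial terms: `G ⊆ J`, each marked term is the
initial term of its binomial, and the marked terms generate the initial ideal of `J`. -/
def IsMarkedGB {V K : Type*} [Field K] (gt : (V →₀ ℕ) → (V →₀ ℕ) → Prop)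
    (G : Set (MarkedBinomial V)) (J : Ideal (MvPolynomial V K)) : Prop :=
  (∀ g ∈ G, g.toPoly K ∈ J) ∧ (∀ g ∈ G, gt g.head g.tail) ∧
    Ideal.span ((fun g => (MvPolynomial.monomial g.head (1 : K) : MvPolynomial V K)) '' G) =
      Ideal.span {p : MvPolynomial V K |
        ∃ f ∈ J, f ≠ 0 ∧ ∃ m, IsInitialTerm gt f m ∧ p = MvPolynomial.monomial m (1 : K)}

/-- One-step reduction of a monomial (exponent vector) with respect to a collection of
marked binomials: replace an occurrence of a marked term by the corresponding tail. -/
def Reduces {V : Type*} (G : Set (MarkedBinomial V)) (m m' : V →₀ ℕ) : Prop :=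
  ∃ g ∈ G, g.head ≤ m ∧ m' = m - g.head + g.tail

/-- One-step reduction of a polynomial with respect to a collection of marked binomials. -/
noncomputable def PolyReduces {V K : Type*} [Field K] (G : Set (MarkedBinomial V))
    (f f' : MvPolynomial V K) : Prop :=
  ∃ g ∈ G, ∃ m ∈ f.support, g.head ≤ m ∧
    f' = f - MvPolynomial.monomial (m - g.head) (MvPolynomial.coeff m f) * g.toPoly K

/-- The image monomial (in the `W`-variables) of a monomial `T` in the `V`-variables under
the monomial map sending the variable `v` to the monomial with exponent vector `u v`. -/
noncomputable def fiberMap {V W : Type*} (u : V → (W →₀ ℕ)) (T : V →₀ ℕ) : W →₀ ℕ :=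
  T.sum fun v e => e • u v

/-- `T` is a sink of the fiber graph over the multidegree `μ` (with respect to the
marked binomials `G` and the monomial map determined by `u`): it lies in the fiber and
has no outgoing edge inside the fiber. -/
noncomputable def IsFiberSink {V W : Type*} (G : Set (MarkedBinomial V)) (u : V → (W →₀ ℕ))
    (μ : W →₀ ℕ) (T : V →₀ ℕ) : Prop :=
  fiberMap u T = μ ∧ ∀ T', Reduces G T T' → fiberMap u T' ≠ μ

/-- `I` is a monomial ideal. -/
def IsMonomialIdeal {n : ℕ} {K : Type*} [Field K] (I : Ideal (MvPolynomial (Fin n) K)) : Prop :=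
  ∃ M : Set (Fin n →₀ ℕ), I = Ideal.span ((fun m => (MvPolynomial.monomial m (1 : K))) '' M)

/-- `I` is a strongly stable (Borel) ideal: a monomial ideal such that whenever `x_i`
divides a monomial `m ∈ I` and `j < i`, also `x_j · m / x_i ∈ I`. -/
def StronglyStable {n : ℕ} {K : Type*} [Field K] (I : Ideal (MvPolynomial (Fin n) K)) : Prop :=
  IsMonomialIdeal I ∧ ∀ m : Fin n →₀ ℕ, MvPolynomial.monomial m (1 : K) ∈ I →
    ∀ i j : Fin n, j < i → m i ≠ 0 →
      MvPolynomial.monomial (m - Finsupp.single i 1 + Finsupp.single j 1) (1 : K) ∈ I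

/-- The smallest strongly stable ideal containing the given monomials. -/
noncomputable def smallestStronglyStable {n : ℕ} (K : Type*) [Field K]
    (Ms : Set (Fin n →₀ ℕ)) : Ideal (MvPolynomial (Fin n) K) :=
  sInf {I | StronglyStable I ∧ ∀ m ∈ Ms, MvPolynomial.monomial m (1 : K) ∈ I}

/-- The minimal monomial generators of an ideal generated in the single degree `d`:
the degree-`d` monomials lying in `I`. -/
def MinGens {n : ℕ} {K : Type*} [Field K] (I : Ideal (MvPolynomial (Fin n) K)) (d : ℕ) :
    Set (Fin n →₀ ℕ) :=
  {m | (m.sum fun _ e => e) = d ∧ MvPolynomial.monomial m (1 : K) ∈ I}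

/-- `u ≻_rlex v` (reverse lexicographic, `x_1 > … > x_n`, for exponent vectors of equal
total degree): at the largest index where they differ, `u` has the smaller exponent. -/
def RlexGt {n : ℕ} (u v : Fin n →₀ ℕ) : Prop :=
  ∃ k : Fin n, u k < v k ∧ ∀ l : Fin n, k < l → u l = v l

/-- The (degree-)reverse lexicographic order on monomials of `K[V]` induced by the strict
variable order `vgt` (where `vgt k l` means the variable `k` is greater than `l`). -/
def VarRevlexGt {V : Type*} (vgt : V → V → Prop) (m m' : V →₀ ℕ) : Prop :=
  (m.sum fun _ e => e) > (m'.sum fun _ e => e) ∨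
    ((m.sum fun _ e => e) = (m'.sum fun _ e => e) ∧
      ∃ k, m k < m' k ∧ ∀ l, vgt k l → m l = m' l)

/-- The minimal monomial generators of the strongly stable ideal `B(x_a x_b)` (`a ≤ b`):
the monomials `x_i x_j` with `i ≤ j`, `i ≤ a`, `j ≤ b`. -/
def BM {n : ℕ} (a b : Fin n) : Set (Fin n →₀ ℕ) :=
  {m | ∃ i j : Fin n, i ≤ j ∧ i ≤ a ∧ j ≤ b ∧ m = Finsupp.single i 1 + Finsupp.single j 1}

/-- The minimal monomial generators of `B(x_c x_d)` not in `B(x_a x_b)` (for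
`c < a ≤ b < d`): the monomials `x_i x_j` with `i ≤ c` and `b < j ≤ d`. -/
def BN {n : ℕ} (b c d : Fin n) : Set (Fin n →₀ ℕ) :=
  {m | ∃ i j : Fin n, i ≤ c ∧ b < j ∧ j ≤ d ∧ m = Finsupp.single i 1 + Finsupp.single j 1}

/-- `u ≻_mrlex v`: every element of `B_N` is greater than every element of `B_M`, and
within `B_M` (resp. `B_N`) the order agrees with `≻_rlex`. -/
def MrlexGt {n : ℕ} (a b c d : Fin n) (u v : Fin n →₀ ℕ) : Prop :=
  (u ∈ BN b c d ∧ v ∈ BM a b) ∨ (u ∈ BM a b ∧ v ∈ BM a b ∧ RlexGt u v) ∨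
    (u ∈ BN b c d ∧ v ∈ BN b c d ∧ RlexGt u v)

/-- The collection `G₁` of marked binomials `T_u T_v − T_{u'} T_{v'}` with `u v = u' v'`
and `u, v ≻_rlex v'`, marked at `T_u T_v`. -/
def G1 {n : ℕ} (a b c d : Fin n) : Set (MarkedBinomial ↥(BM a b ∪ BN b c d)) :=
  {g | ∃ u v u' v' : ↥(BM a b ∪ BN b c d),
    (u : Fin n →₀ ℕ) + (v : Fin n →₀ ℕ) = (u' : Fin n →₀ ℕ) + (v' : Fin n →₀ ℕ) ∧
    RlexGt (u : Fin n →₀ ℕ) (v' : Fin n →₀ ℕ) ∧ RlexGt (v : Fin n →₀ ℕ) (v' : Fin n →₀ ℕ) ∧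
    g.head = Finsupp.single u 1 + Finsupp.single v 1 ∧
    g.tail = Finsupp.single u' 1 + Finsupp.single v' 1}

/-- The collection `G₂` of marked binomials `T_u T_v − T_{u'} T_{v'}` with `u v = u' v'`
and `u, v ≻_mrlex v'`, marked at `T_u T_v`. -/
def G2 {n : ℕ} (a b c d : Fin n) : Set (MarkedBinomial ↥(BM a b ∪ BN b c d)) :=
  {g | ∃ u v u' v' : ↥(BM a b ∪ BN b c d),
    (u : Fin n →₀ ℕ) + (v : Fin n →₀ ℕ) = (u' : Fin n →₀ ℕ) + (v' : Fin n →₀ ℕ) ∧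
    MrlexGt a b c d (u : Fin n →₀ ℕ) (v' : Fin n →₀ ℕ) ∧
    MrlexGt a b c d (v : Fin n →₀ ℕ) (v' : Fin n →₀ ℕ) ∧
    g.head = Finsupp.single u 1 + Finsupp.single v 1 ∧
    g.tail = Finsupp.single u' 1 + Finsupp.single v' 1}

/-- `w` is the smallest (with respect to the variable order induced by `≻_rlex`) variable
factor of the monomial `T` whose underlying monomial lies in `S`. -/
def IsLeastFactorIn {n : ℕ} {V : Set (Fin n →₀ ℕ)} (S : Set (Fin n →₀ ℕ))
    (T : ↥V →₀ ℕ) (w : ↥V) : Prop :=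
  w ∈ T.support ∧ (w : Fin n →₀ ℕ) ∈ S ∧
    ∀ v ∈ T.support, (v : Fin n →₀ ℕ) ∈ S →
      v = w ∨ RlexGt (v : Fin n →₀ ℕ) (w : Fin n →₀ ℕ)

/-- `m` is the `≻_rlex`-smallest element of `S` dividing `μ`. -/
def IsLeastDivisorIn {n : ℕ} (S : Set (Fin n →₀ ℕ)) (μ m : Fin n →₀ ℕ) : Prop :=
  m ∈ S ∧ m ≤ μ ∧ ∀ m' ∈ S, m' ≤ μ → m' = m ∨ RlexGt m' m

open Finsupp in
/-- The monomials `x_i x_j` in `BM a b ∪ BN b c d` stay in this set when `x_i` is replaced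
by a variable of smaller index. -/
theorem single_add_single_mem_of_lt {n : ℕ} {a b c d : Fin n} (h1 : c < a) (h2 : a ≤ b)
    {i p k : Fin n} (hip : i < p)
    (h : (single p 1 + single k 1 : Fin n →₀ ℕ) ∈ BM a b ∪ BN b c d) :
    (single i 1 + single k 1 : Fin n →₀ ℕ) ∈ BM a b ∪ BN b c d := by
  have pair_mem_BM : ∀ s t : Fin n, s ≤ a → t ≤ a ∨ s ≤ t → t ≤ b →
      (single s 1 + single t 1 : Fin n →₀ ℕ) ∈ BM a b := by
    intro s t hs hst ht
    rcases le_total s t with hle | hle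
    · exact ⟨s, t, hle, hs, ht, rfl⟩
    · exact ⟨t, s, hle, by grind, by grind, add_comm _ _⟩
  have pair_eq : ∀ s t : Fin n,
      (single p 1 + single k 1 : Fin n →₀ ℕ) = single s 1 + single t 1 →
        (p = s ∧ k = t) ∨ (p = t ∧ k = s) := by
    intro s t he
    rcases (single_add_single_eq_single_add_single one_ne_zero one_ne_zero).1 he with h | h | h
    · exact Or.inl ⟨h.1, h.2⟩
    · exact Or.inr ⟨h.2.1, h.2.2⟩
    · simp at h
  rcases h with ⟨s, t, hst, hs, ht, he⟩ | ⟨s, t, hs, hbt, ht, he⟩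
  · rcases pair_eq s t he with ⟨rfl, rfl⟩ | ⟨rfl, rfl⟩
    · exact Or.inl (pair_mem_BM _ _ (by grind) (by grind) ht)
    · exact Or.inl (add_comm (single k 1) (single i 1) ▸
        pair_mem_BM k i hs (by grind) (by grind))
  · rcases pair_eq s t he with ⟨rfl, rfl⟩ | ⟨rfl, rfl⟩
    · exact Or.inr ⟨i, k, by grind, hbt, ht, rfl⟩
    · rcases le_or_gt i b with hi | hi
      · exact Or.inl (add_comm (single k 1) (single i 1) ▸
          pair_mem_BM k i (by grind) (by grind) hi)
      · exact Or.inr ⟨k, i, hs, hi, by grind, add_comm _ _⟩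

theorem exists_eq_single_add_single {n : ℕ} {a b c d : Fin n} {m : Fin n →₀ ℕ}
    (h : m ∈ BM a b ∪ BN b c d) :
    ∃ i j : Fin n, m = Finsupp.single i 1 + Finsupp.single j 1 := by
  rcases h with ⟨i, j, -, -, -, h⟩ | ⟨i, j, -, -, -, h⟩ <;> exact ⟨i, j, h⟩

theorem exists_eq_single_add_single_of_ne_zero {n : ℕ} {a b c d : Fin n} {m : Fin n →₀ ℕ}
    (h : m ∈ BM a b ∪ BN b c d) {p : Fin n} (hp : m p ≠ 0) :
    ∃ k : Fin n, m = Finsupp.single p 1 + Finsupp.single k 1 := by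
  obtain ⟨i, j, rfl⟩ := exists_eq_single_add_single h
  by_cases hi : i = p
  · exact ⟨j, by rw [hi]⟩
  · by_cases hj : j = p
    · exact ⟨i, by rw [hj, add_comm]⟩
    · simp [hi, hj] at hp

theorem RlexGt.of_add_right {n : ℕ} {u v w : Fin n →₀ ℕ} (h : RlexGt (u + w) (v + w)) :
    RlexGt u v := by
  simpa [RlexGt] using h

theorem RlexGt.lt_of_single {n : ℕ} {i p : Fin n}
    (h : RlexGt (Finsupp.single i 1) (Finsupp.single p 1)) : i < p := by
  obtain ⟨k, hk, hl⟩ := h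
  obtain rfl : p = k := by
    by_contra hpk
    simp [hpk] at hk
  by_contra hip
  rcases (not_lt.1 hip).eq_or_lt with rfl | hlt
  · simp at hk
  · simpa [hlt.ne] using hl i hlt

section fiberMap

variable {V W : Type*} {u : V → (W →₀ ℕ)}

theorem fiberMap_add (S T : V →₀ ℕ) : fiberMap u (S + T) = fiberMap u S + fiberMap u T :=
  Finsupp.sum_add_index' (by simp) (by simp [add_smul])

theorem fiberMap_single (v : V) : fiberMap u (Finsupp.single v 1) = u v := by
  simp [fiberMap]

theorem exists_single_add_of_fiberMap_ne_zero {T : V →₀ ℕ} {p : W} (h : fiberMap u T p ≠ 0) :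
    ∃ v Z, u v p ≠ 0 ∧ T = Finsupp.single v 1 + Z := by
  rw [fiberMap, Finsupp.sum_apply] at h
  obtain ⟨v, hv, hvp⟩ := Finset.exists_ne_zero_of_sum_ne_zero h
  have hle : Finsupp.single v 1 ≤ T :=
    Finsupp.single_le_iff.2 (Nat.one_le_iff_ne_zero.2 (Finsupp.mem_support_iff.1 hv))
  exact ⟨v, T - Finsupp.single v 1, fun h0 => hvp (by simp [h0]), (add_tsub_cancel_of_le hle).symm⟩

/-- Removing a factor from a sink leaves a sink of the corresponding smaller fiber graph. -/
theorem IsFiberSink.of_add {G : Set (MarkedBinomial V)} {μ : W →₀ ℕ} {v : V} {Z : V →₀ ℕ}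
    (h : IsFiberSink G u μ (Finsupp.single v 1 + Z)) : IsFiberSink G u (μ - u v) Z := by
  obtain ⟨rfl, h⟩ := h
  simp only [fiberMap_add, fiberMap_single, add_tsub_cancel_left] at h ⊢
  refine ⟨rfl, ?_⟩
  rintro T' ⟨g, hg, hle, rfl⟩ heq
  refine h (Finsupp.single v 1 + (Z - g.head + g.tail))
    ⟨g, hg, hle.trans le_add_self, ?_⟩ (by rw [fiberMap_add, fiberMap_single, heq])
  rw [← add_assoc, add_tsub_assoc_of_le hle]

end fiberMap

open Finsupp in
/-- A sink is divisible by the variable of the `≻_rlex`-smallest generator dividing `μ`. -/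
theorem IsFiberSink.exists_eq_single_add {n : ℕ} {a b c d : Fin n} (h1 : c < a) (h2 : a ≤ b)
    {μ : Fin n →₀ ℕ} (m : ↥(BM a b ∪ BN b c d))
    (hm : IsLeastDivisorIn (BM a b ∪ BN b c d) μ m) {T : ↥(BM a b ∪ BN b c d) →₀ ℕ}
    (hT : IsFiberSink (G1 a b c d) (fun w : ↥(BM a b ∪ BN b c d) => (w : Fin n →₀ ℕ)) μ T) :
    ∃ Z, T = single m 1 + Z ∧
      IsFiberSink (G1 a b c d) (fun w : ↥(BM a b ∪ BN b c d) => (w : Fin n →₀ ℕ)) (μ - m) Z := by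
  suffices hfac : ∃ Z, T = single m 1 + Z by
    obtain ⟨Z, rfl⟩ := hfac
    exact ⟨Z, rfl, hT.of_add⟩
  obtain ⟨hμ, hsink⟩ := hT
  obtain ⟨-, hmμ, hleast⟩ := hm
  obtain ⟨p, q, hpq⟩ := exists_eq_single_add_single m.2
  have hq : fiberMap (fun w : ↥(BM a b ∪ BN b c d) => (w : Fin n →₀ ℕ)) T q ≠ 0 := by
    have := hmμ q
    rw [hpq] at this
    simp at this
    rw [hμ]
    omega
  obtain ⟨w, Z, hwq, rfl⟩ := exists_single_add_of_fiberMap_ne_zero hq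
  obtain ⟨i, hw⟩ := exists_eq_single_add_single_of_ne_zero w.2 hwq
  rw [fiberMap_add, fiberMap_single] at hμ
  rcases hleast w w.2 (hμ ▸ le_self_add) with hwm | hwm
  · exact ⟨Z, by rw [Subtype.ext hwm]⟩
  have hip : i < p := by
    rw [hw, hpq, add_comm] at hwm
    exact hwm.of_add_right.lt_of_single
  have hp : fiberMap (fun w : ↥(BM a b ∪ BN b c d) => (w : Fin n →₀ ℕ)) Z p ≠ 0 := by
    have := hmμ p
    rw [hpq, ← hμ, hw] at this
    simp [hip.ne] at this
    omega
  obtain ⟨v, Y, hvp, rfl⟩ := exists_single_add_of_fiberMap_ne_zero hp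
  obtain ⟨k, hv⟩ := exists_eq_single_add_single_of_ne_zero v.2 hvp
  rw [fiberMap_add, fiberMap_single] at hμ
  rcases hleast v v.2 (hμ ▸ le_self_add.trans le_add_self) with hvm | hvm
  · exact ⟨single w 1 + Y, by rw [Subtype.ext hvm, add_left_comm]⟩
  let u' : ↥(BM a b ∪ BN b c d) :=
    ⟨single i 1 + single k 1, single_add_single_mem_of_lt h1 h2 hip (hv ▸ v.2)⟩
  have hsum : (w : Fin n →₀ ℕ) + v = u' + m := by
    rw [hw, hv, hpq]
    simp only [u']
    abel
  refine (hsink (Y + (single u' 1 + single m 1)) ⟨⟨single w 1 + single v 1,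
    single u' 1 + single m 1⟩, ⟨w, v, u', m, hsum, hwm, hvm, rfl, rfl⟩, ?_, ?_⟩ ?_).elim
  · rw [← add_assoc]
    exact le_self_add
  · rw [← add_assoc (single w 1), add_tsub_cancel_left]
  · simp only [fiberMap_add, fiberMap_single]
    rw [← hsum, ← hμ]
    abel

/-- Let `I = B(x_a x_b, x_c x_d)` with `c < a ≤ b < d` and let `μ` be a
monomial with nonempty fiber graph `Γ_μ(I)` with respect to `G₁`. If `Γ_μ(I)` has a
vertex of type `M` (all variable factors from `B_M`), then every sink is of the form
`T_{M'}·Z` with `Z` a sink of `Γ_{μ/M'}(I)`, where `M'` is the `≻_rlex`-smallest element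
of `B_M` dividing `μ`; otherwise every sink is of the form `T_{N'}·Z` with `Z` a sink of
`Γ_{μ/N'}(I)`. -/
theorem sink_reduction_rlex {n : ℕ} (a b c d : Fin n)
    (h1 : c < a) (h2 : a ≤ b) (h3 : b < d) (μ : Fin n →₀ ℕ)
    (hne : ∃ T : ↥(BM a b ∪ BN b c d) →₀ ℕ,
      fiberMap (fun w : ↥(BM a b ∪ BN b c d) => (w : Fin n →₀ ℕ)) T = μ) :
    (∀ (M' : Fin n →₀ ℕ) (uM' : ↥(BM a b ∪ BN b c d)),
      IsLeastDivisorIn (BM a b) μ M' → (uM' : Fin n →₀ ℕ) = M' →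
      (∃ T : ↥(BM a b ∪ BN b c d) →₀ ℕ,
        fiberMap (fun w : ↥(BM a b ∪ BN b c d) => (w : Fin n →₀ ℕ)) T = μ ∧
          ∀ w ∈ T.support, (w : Fin n →₀ ℕ) ∈ BM a b) →
      ∀ T : ↥(BM a b ∪ BN b c d) →₀ ℕ,
        IsFiberSink (G1 a b c d) (fun w : ↥(BM a b ∪ BN b c d) => (w : Fin n →₀ ℕ)) μ T →
        ∃ Z : ↥(BM a b ∪ BN b c d) →₀ ℕ,
          T = Finsupp.single uM' 1 + Z ∧
          IsFiberSink (G1 a b c d) (fun w : ↥(BM a b ∪ BN b c d) => (w : Fin n →₀ ℕ))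
            (μ - M') Z) ∧
    (∀ (N' : Fin n →₀ ℕ) (uN' : ↥(BM a b ∪ BN b c d)),
      IsLeastDivisorIn (BN b c d) μ N' → (uN' : Fin n →₀ ℕ) = N' →
      (¬ ∃ T : ↥(BM a b ∪ BN b c d) →₀ ℕ,
        fiberMap (fun w : ↥(BM a b ∪ BN b c d) => (w : Fin n →₀ ℕ)) T = μ ∧
          ∀ w ∈ T.support, (w : Fin n →₀ ℕ) ∈ BM a b) →
      ∀ T : ↥(BM a b ∪ BN b c d) →₀ ℕ,
        IsFiberSink (G1 a b c d) (fun w : ↥(BM a b ∪ BN b c d) => (w : Fin n →₀ ℕ)) μ T →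
        ∃ Z : ↥(BM a b ∪ BN b c d) →₀ ℕ,
          T = Finsupp.single uN' 1 + Z ∧
          IsFiberSink (G1 a b c d) (fun w : ↥(BM a b ∪ BN b c d) => (w : Fin n →₀ ℕ))
            (μ - N') Z) := by
  refine ⟨?_, ?_⟩
  · rintro _ m ⟨hM, hle, hleast⟩ rfl ⟨S, hS, hSM⟩ T hT
    refine hT.exists_eq_single_add h1 h2 m ⟨m.2, hle, ?_⟩
    rintro w (hw | ⟨i, j, -, hbj, -, rfl⟩) hwμ
    · exact hleast w hw hwμ
    · have hj : fiberMap (fun w : ↥(BM a b ∪ BN b c d) => (w : Fin n →₀ ℕ)) S j ≠ 0 := by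
        have := hwμ j
        simp at this
        rw [hS]
        omega
      obtain ⟨v, Z, hvj, rfl⟩ := exists_single_add_of_fiberMap_ne_zero hj
      obtain ⟨s, t, hst, -, ht, hv⟩ := hSM v (by simp)
      have hsj : s ≠ j := by grind
      have htj : t ≠ j := by grind
      simp [hv, hsj, htj] at hvj
  · rintro _ m ⟨hN, hle, hleast⟩ rfl - T hT
    refine hT.exists_eq_single_add h1 h2 m ⟨m.2, hle, ?_⟩
    rintro w (⟨s, t, hst, -, ht, rfl⟩ | hw) hwμ
    · obtain ⟨i, j, hi, hbj, -, hm⟩ := hN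
      refine Or.inr ⟨j, ?_, fun l hl => ?_⟩
      · have hsj : s ≠ j := by grind
        have htj : t ≠ j := by grind
        simp [hm, hsj, htj]
      · have hsl : s ≠ l := by grind
        have htl : t ≠ l := by grind
        have hil : i ≠ l := by grind
        simp [hm, hsl, htl, hil, hl.ne]
    · exact hleast w hw hwμ
end

section
/- Let I = B(M,N) ⊆ S = K[x_1, …, x_n] with Borel generators M = x_a·x_b and N = x_c·x_d, c < a ≤ b < d, and let G₂ = { T_u T_v − T_{u'} T_{v'} : u·v = u'·v' and u, v ≻_mrlex v' } be marked at the terms T_u T_v. Then for every monomial μ ∈ S, the fiber graph Γ_μ(I) with respect to G₂ is either empty or has a unique sink. -/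
theorem fiberMap_eq_linearCombination {V W : Type*} (u : V → (W →₀ ℕ)) (T : V →₀ ℕ) :
    fiberMap u T = Finsupp.linearCombination ℕ u T := rfl

theorem exists_mem_support_of_fiberMap_ne_zero {V W : Type*} (u : V → (W →₀ ℕ)) (T : V →₀ ℕ)
    {i : W} (h : fiberMap u T i ≠ 0) : ∃ v ∈ T.support, u v i ≠ 0 := by
  by_contra! hc
  apply h
  rw [fiberMap, Finsupp.sum, Finsupp.finsetSum_apply]
  exact Finset.sum_eq_zero fun v hv => by simp [hc v hv]

theorem single_add_single_le {V : Type*} {T : V →₀ ℕ} {u v : V} (hu : u ∈ T.support)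
    (hv : v ∈ T.support) (huv : u ≠ v) :
    Finsupp.single u 1 + Finsupp.single v 1 ≤ T := by
  classical
  intro x
  simp only [Finsupp.mem_support_iff] at hu hv
  simp only [Finsupp.add_apply, Finsupp.single_apply]
  by_cases h1 : u = x <;> by_cases h2 : v = x <;> simp [h1, h2]
  · exact absurd (h1.trans h2.symm) huv
  · subst h1; omega
  · subst h2; omega

/-- If `x_i x_j` divides the image of `T` but is not the image of a factor of `T`, then `x_i` and
`x_j` are contributed by two different factors (with multiplicity) of `T`. -/
theorem exists_pair_of_le_fiberMap {V W : Type*} (u : V → (W →₀ ℕ)) (T : V →₀ ℕ) {i j : W}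
    (hle : Finsupp.single i 1 + Finsupp.single j 1 ≤ fiberMap u T)
    (hquad : ∀ x : V, ∀ i, u x i ≠ 0 → ∃ k, u x = Finsupp.single i 1 + Finsupp.single k 1)
    (hne : ∀ x ∈ T.support, u x ≠ Finsupp.single i 1 + Finsupp.single j 1) :
    ∃ x y k l, Finsupp.single x 1 + Finsupp.single y 1 ≤ T ∧
      u x = Finsupp.single i 1 + Finsupp.single k 1 ∧
      u y = Finsupp.single j 1 + Finsupp.single l 1 := by
  classical
  have hi : fiberMap u T i ≠ 0 := by
    have := hle i
    simp only [Finsupp.add_apply, Finsupp.single_eq_same] at this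
    omega
  obtain ⟨x, hx, hxi⟩ := exists_mem_support_of_fiberMap_ne_zero u T hi
  obtain ⟨k, hk⟩ := hquad x i hxi
  have hkj : k ≠ j := fun h => hne x hx (h ▸ hk)
  have hxT : Finsupp.single x 1 ≤ T := by
    rw [Finsupp.single_le_iff]
    exact Nat.one_le_iff_ne_zero.2 (Finsupp.mem_support_iff.1 hx)
  obtain ⟨R, rfl⟩ := exists_add_of_le hxT
  have hj : fiberMap u R j ≠ 0 := by
    have := hle j
    rw [fiberMap_eq_linearCombination, map_add, Finsupp.linearCombination_single, one_smul, hk,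
      ← fiberMap_eq_linearCombination] at this
    simp only [Finsupp.add_apply, Finsupp.single_apply, if_neg hkj, if_true] at this
    omega
  obtain ⟨y, hy, hyj⟩ := exists_mem_support_of_fiberMap_ne_zero u R hj
  obtain ⟨l, hl⟩ := hquad y j hyj
  refine ⟨x, y, k, l, ?_, hk, hl⟩
  gcongr
  rw [Finsupp.single_le_iff]
  exact Nat.one_le_iff_ne_zero.2 (Finsupp.mem_support_iff.1 hy)

section Rlex

variable {n : ℕ}

theorem RlexGt.irrefl (u : Fin n →₀ ℕ) : ¬ RlexGt u u := fun ⟨_, h, _⟩ => lt_irrefl _ h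

theorem RlexGt.trans {u v w : Fin n →₀ ℕ} : RlexGt u v → RlexGt v w → RlexGt u w := by
  rintro ⟨k, hk, hk'⟩ ⟨l, hl, hl'⟩
  rcases lt_trichotomy k l with h | rfl | h
  · exact ⟨l, (hk' l h).trans_lt hl, fun m hm => (hk' m (h.trans hm)).trans (hl' m hm)⟩
  · exact ⟨k, hk.trans hl, fun m hm => (hk' m hm).trans (hl' m hm)⟩
  · exact ⟨k, hk.trans_eq (hl' k h), fun m hm => (hk' m hm).trans (hl' m (h.trans hm))⟩

theorem RlexGt.total {u v : Fin n →₀ ℕ} (h : u ≠ v) : RlexGt u v ∨ RlexGt v u := by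
  classical
  have hne : (Finset.univ.filter fun k => u k ≠ v k).Nonempty := by
    obtain ⟨k, hk⟩ := Finsupp.ne_iff.1 h
    exact ⟨k, by simpa using hk⟩
  obtain ⟨k, hk, hmax⟩ := Finset.exists_max_image _ id hne
  have heq : ∀ l, k < l → u l = v l := fun l hl => by
    by_contra hl'
    exact absurd (hmax l (by simpa using hl')) (not_le.2 hl)
  rcases lt_or_gt_of_ne (Finset.mem_filter.1 hk).2 with hlt | hlt
  · exact Or.inl ⟨k, hlt, heq⟩
  · exact Or.inr ⟨k, hlt, fun l hl => (heq l hl).symm⟩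

theorem rlexGt_add_single {p : Fin n →₀ ℕ} {k j : Fin n} :
    RlexGt (p + Finsupp.single k 1) (p + Finsupp.single j 1) ↔ k < j := by
  constructor
  · rintro ⟨m, hm, hm'⟩
    have hmj : m = j := by
      by_contra hne
      simp [Finsupp.single_apply, Ne.symm hne] at hm
    subst hmj
    rcases lt_trichotomy k m with h | rfl | h
    · exact h
    · exact absurd hm (lt_irrefl _)
    · have := hm' k h
      simp [h.ne] at this
  · intro h
    refine ⟨j, by simp [h.ne], fun l hl => ?_⟩
    simp [hl.ne, (h.trans hl).ne]

theorem RlexGt.le_of_pair {p q i j : Fin n} (hij : i ≤ j)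
    (h : RlexGt (Finsupp.single p 1 + Finsupp.single q 1)
      (Finsupp.single i 1 + Finsupp.single j 1)) : q ≤ j := by
  obtain ⟨k, hk, hk'⟩ := h
  by_contra! hq
  have hkj : k ≤ j := by
    by_contra! hc
    simp [Finsupp.single_apply, hc.ne, (hij.trans_lt hc).ne] at hk
  have := hk' q (hkj.trans_lt hq)
  simp [Finsupp.single_apply, hq.ne, (hij.trans_lt hq).ne] at this

end Rlex

section Generators

variable {n : ℕ} {a b c d : Fin n}

theorem exists_eq_single_add_single_of_mem_BM (h2 : a ≤ b) {x : Fin n →₀ ℕ} (hx : x ∈ BM a b)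
    {i : Fin n} (hi : x i ≠ 0) :
    ∃ k, x = Finsupp.single i 1 + Finsupp.single k 1 ∧ i ≤ b ∧ k ≤ b ∧ (i ≤ a ∨ k ≤ a) := by
  obtain ⟨p, q, hpq, hp, hq, rfl⟩ := hx
  by_cases h : p = i
  · subst h; exact ⟨q, rfl, hp.trans h2, hq, Or.inl hp⟩
  · by_cases h' : q = i
    · subst h'; exact ⟨p, add_comm _ _, hq, hp.trans h2, Or.inr hp⟩
    · simp [h, h'] at hi

theorem exists_eq_single_add_single_of_mem_BN {x : Fin n →₀ ℕ} (hx : x ∈ BN b c d)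
    {i : Fin n} (hi : x i ≠ 0) :
    ∃ k, x = Finsupp.single i 1 + Finsupp.single k 1 ∧
      ((i ≤ c ∧ b < k ∧ k ≤ d) ∨ (k ≤ c ∧ b < i ∧ i ≤ d)) := by
  obtain ⟨p, q, hp, hq, hqd, rfl⟩ := hx
  by_cases h : p = i
  · subst h; exact ⟨q, rfl, Or.inl ⟨hp, hq, hqd⟩⟩
  · by_cases h' : q = i
    · subst h'; exact ⟨p, add_comm _ _, Or.inr ⟨hp, hq, hqd⟩⟩
    · simp [h, h'] at hi

theorem single_add_single_mem_BM {i k : Fin n} (hi : i ≤ b) (hk : k ≤ b) (h : i ≤ a ∨ k ≤ a) :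
    Finsupp.single i 1 + Finsupp.single k 1 ∈ BM a b := by
  rcases le_total i k with hik | hik
  · exact ⟨i, k, hik, h.elim id hik.trans, hk, rfl⟩
  · exact ⟨k, i, hik, h.elim hik.trans id, hi, add_comm _ _⟩

theorem apply_eq_zero_of_mem_BM (h2 : a ≤ b) {x : Fin n →₀ ℕ} (hx : x ∈ BM a b) {k : Fin n}
    (hk : b < k) : x k = 0 := by
  by_contra h
  obtain ⟨_, _, h', _⟩ := exists_eq_single_add_single_of_mem_BM h2 hx h
  exact absurd h' (not_le.2 hk)

theorem notMem_BM_of_mem_BN (h2 : a ≤ b) {x : Fin n →₀ ℕ} (hx : x ∈ BN b c d) : x ∉ BM a b := by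
  intro hx'
  obtain ⟨p, q, hp, hq, hqd, rfl⟩ := hx
  have := apply_eq_zero_of_mem_BM h2 hx' hq
  simp at this

theorem MrlexGt.rlexGt (h2 : a ≤ b) {u v : Fin n →₀ ℕ} (h : MrlexGt a b c d u v)
    (hu : u ∈ BM a b) : RlexGt u v := by
  rcases h with h | h | h
  · exact absurd hu (notMem_BM_of_mem_BN h2 h.1)
  · exact h.2.2
  · exact h.2.2

theorem MrlexGt.mem_BN (h2 : a ≤ b) {u v : Fin n →₀ ℕ} (h : MrlexGt a b c d u v)
    (hv : v ∈ BN b c d) : u ∈ BN b c d := by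
  rcases h with h | h | h
  · exact h.1
  · exact absurd h.2.1 (notMem_BM_of_mem_BN h2 hv)
  · exact h.1

theorem MrlexGt.irrefl (h2 : a ≤ b) (u : Fin n →₀ ℕ) : ¬ MrlexGt a b c d u u := by
  rintro (h | h | h)
  · exact notMem_BM_of_mem_BN h2 h.1 h.2
  · exact RlexGt.irrefl _ h.2.2
  · exact RlexGt.irrefl _ h.2.2

theorem MrlexGt.trans (h2 : a ≤ b) {u v w : Fin n →₀ ℕ} :
    MrlexGt a b c d u v → MrlexGt a b c d v w → MrlexGt a b c d u w := by
  rintro (h | h | h) (h' | h' | h')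
  · exact absurd h.2 (notMem_BM_of_mem_BN h2 h'.1)
  · exact Or.inl ⟨h.1, h'.2.1⟩
  · exact absurd h.2 (notMem_BM_of_mem_BN h2 h'.1)
  · exact absurd h.2.1 (notMem_BM_of_mem_BN h2 h'.1)
  · exact Or.inr (Or.inl ⟨h.1, h'.2.1, h.2.2.trans h'.2.2⟩)
  · exact absurd h.2.1 (notMem_BM_of_mem_BN h2 h'.1)
  · exact Or.inl ⟨h.1, h'.2⟩
  · exact absurd h'.1 (notMem_BM_of_mem_BN h2 h.2.1)
  · exact Or.inr (Or.inr ⟨h.1, h'.2.1, h.2.2.trans h'.2.2⟩)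

theorem MrlexGt.total {u v : ↥(BM a b ∪ BN b c d)} (h : u ≠ v) :
    MrlexGt a b c d u v ∨ MrlexGt a b c d v u := by
  have h' : (u : Fin n →₀ ℕ) ≠ v := fun e => h (Subtype.ext e)
  have ht := RlexGt.total h'
  obtain ⟨u, hu | hu⟩ := u <;> obtain ⟨v, hv | hv⟩ := v <;> unfold MrlexGt <;> tauto

instance finite_generators : Finite ↥(BM a b ∪ BN b c d) := by
  have hfin : (Set.range fun p : Fin n × Fin n =>
      (Finsupp.single p.1 1 + Finsupp.single p.2 1 : Fin n →₀ ℕ)).Finite := Set.finite_range _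
  refine (hfin.subset ?_).to_subtype
  rintro x (⟨i, j, _, _, _, rfl⟩ | ⟨i, j, _, _, _, rfl⟩)
  · exact ⟨(i, j), rfl⟩
  · exact ⟨(i, j), rfl⟩

theorem exists_rank (h2 : a ≤ b) : ∃ r : ↥(BM a b ∪ BN b c d) → ℕ,
    ∀ u v : ↥(BM a b ∪ BN b c d), MrlexGt a b c d u v → r u < r v := by
  classical
  have := Fintype.ofFinite ↥(BM a b ∪ BN b c d)
  refine ⟨fun u => (Finset.univ.filter fun w : ↥(BM a b ∪ BN b c d) =>
    MrlexGt a b c d w u).card, fun u v huv => Finset.card_lt_card ?_⟩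
  rw [Finset.ssubset_iff_of_subset]
  · exact ⟨u, by simpa using huv, by simpa using MrlexGt.irrefl h2 _⟩
  · intro w
    simpa using fun hw => MrlexGt.trans h2 hw huv

/-- No marked term of `G2` divides `T`. -/
def IsG2Irreducible (T : ↥(BM a b ∪ BN b c d) →₀ ℕ) : Prop :=
  ∀ u v u' v' : ↥(BM a b ∪ BN b c d), Finsupp.single u 1 + Finsupp.single v 1 ≤ T →
    (u : Fin n →₀ ℕ) + v = u' + v' → MrlexGt a b c d u v' → MrlexGt a b c d v v' → False

theorem isFiberSink_iff (μ : Fin n →₀ ℕ) (T : ↥(BM a b ∪ BN b c d) →₀ ℕ) :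
    IsFiberSink (G2 a b c d) (fun w : ↥(BM a b ∪ BN b c d) => (w : Fin n →₀ ℕ)) μ T ↔
      fiberMap (fun w : ↥(BM a b ∪ BN b c d) => (w : Fin n →₀ ℕ)) T = μ ∧ IsG2Irreducible T := by
  refine and_congr_right fun hT => ⟨fun h u v u' v' hle huv hu hv => ?_, ?_⟩
  · refine h _ ⟨⟨_, _⟩, ⟨u, v, u', v', huv, hu, hv, rfl, rfl⟩, hle, rfl⟩ ?_
    obtain ⟨R, rfl⟩ := exists_add_of_le hle
    rw [← hT]
    simp only [fiberMap_eq_linearCombination, add_tsub_cancel_left, map_add,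
      Finsupp.linearCombination_single, one_smul]
    rw [← huv, add_comm]
  · rintro h T' ⟨g, ⟨u, v, u', v', huv, hu, hv, hg, -⟩, hle, -⟩
    exact (h u v u' v' (hg ▸ hle) huv hu hv).elim

theorem IsG2Irreducible.mono {T T' : ↥(BM a b ∪ BN b c d) →₀ ℕ} (h : IsG2Irreducible T)
    (hle : T' ≤ T) : IsG2Irreducible T' :=
  fun u v u' v' h' => h u v u' v' (h'.trans hle)

theorem exists_isG2Irreducible (h2 : a ≤ b) (T : ↥(BM a b ∪ BN b c d) →₀ ℕ) :
    ∃ T' : ↥(BM a b ∪ BN b c d) →₀ ℕ,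
      fiberMap (fun w : ↥(BM a b ∪ BN b c d) => (w : Fin n →₀ ℕ)) T' =
        fiberMap (fun w : ↥(BM a b ∪ BN b c d) => (w : Fin n →₀ ℕ)) T ∧ IsG2Irreducible T' := by
  obtain ⟨r, hr⟩ := exists_rank (c := c) (d := d) h2
  obtain ⟨B, hB⟩ := (Set.finite_range r).bddAbove
  let W : (↥(BM a b ∪ BN b c d) →₀ ℕ) →ₗ[ℕ] ℕ := Finsupp.linearCombination ℕ fun u => 3 ^ r u
  have hWle : ∀ S, W S ≤ 3 ^ B * S.degree := by
    intro S
    rw [Finsupp.degree_apply, Finset.mul_sum, Finsupp.linearCombination_apply, Finsupp.sum]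
    refine Finset.sum_le_sum fun u _ => ?_
    rw [smul_eq_mul, mul_comm]
    exact Nat.mul_le_mul_right _ (Nat.pow_le_pow_right (by norm_num) (hB ⟨u, rfl⟩))
  induction hm : 3 ^ B * T.degree - W T using Nat.strong_induction_on generalizing T with
  | _ m ih =>
    by_cases hT : IsG2Irreducible T
    · exact ⟨T, rfl, hT⟩
    · unfold IsG2Irreducible at hT
      push Not at hT
      obtain ⟨u, v, u', v', hle, huv, hu, hv, -⟩ := hT
      obtain ⟨R, rfl⟩ := exists_add_of_le hle
      have hlt : W (Finsupp.single u 1 + Finsupp.single v 1 + R) <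
          W (Finsupp.single u' 1 + Finsupp.single v' 1 + R) := by
        simp only [W, map_add, Finsupp.linearCombination_single, one_smul]
        have e1 : 3 ^ (r u + 1) ≤ 3 ^ r v' := Nat.pow_le_pow_right (by norm_num) (hr _ _ hu)
        have e2 : 3 ^ (r v + 1) ≤ 3 ^ r v' := Nat.pow_le_pow_right (by norm_num) (hr _ _ hv)
        have e3 : 0 < 3 ^ r v' := by positivity
        have e4 : 0 < 3 ^ r u' := by positivity
        rw [pow_succ] at e1 e2
        omega
      have hdeg : (Finsupp.single u' 1 + Finsupp.single v' 1 + R).degree =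
          (Finsupp.single u 1 + Finsupp.single v 1 + R).degree := by
        simp [map_add]
      have hb := hWle (Finsupp.single u' 1 + Finsupp.single v' 1 + R)
      rw [hdeg] at hb
      obtain ⟨T', hT', hirr⟩ := ih _ (by rw [hdeg]; omega)
        (Finsupp.single u' 1 + Finsupp.single v' 1 + R) rfl
      refine ⟨T', hT'.trans ?_, hirr⟩
      simp only [fiberMap_eq_linearCombination, map_add, Finsupp.linearCombination_single,
        one_smul, huv]

/-- The least generator dividing the image of an irreducible `T` is a factor of `T`: it cannot be
smaller than all factors of `T`. -/
theorem IsG2Irreducible.not_forall_mrlexGt (h1 : c < a) (h2 : a ≤ b)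
    {T : ↥(BM a b ∪ BN b c d) →₀ ℕ} (hT : IsG2Irreducible T) (m : ↥(BM a b ∪ BN b c d))
    (hle : (m : Fin n →₀ ℕ) ≤
      fiberMap (fun w : ↥(BM a b ∪ BN b c d) => (w : Fin n →₀ ℕ)) T)
    (hM : (m : Fin n →₀ ℕ) ∈ BM a b → ∃ w ∈ T.support, (w : Fin n →₀ ℕ) ∈ BM a b) :
    ¬ ∀ u ∈ T.support, MrlexGt a b c d u m := by
  intro hmin
  have hquad : ∀ (x : ↥(BM a b ∪ BN b c d)) (i : Fin n), (x : Fin n →₀ ℕ) i ≠ 0 →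
      ∃ k, (x : Fin n →₀ ℕ) = Finsupp.single i 1 + Finsupp.single k 1 := by
    rintro ⟨x, hx | hx⟩ i hi
    · exact (exists_eq_single_add_single_of_mem_BM h2 hx hi).imp fun _ h => h.1
    · exact (exists_eq_single_add_single_of_mem_BN hx hi).imp fun _ h => h.1
  have hpair : ∀ {i j : Fin n}, (m : Fin n →₀ ℕ) = Finsupp.single i 1 + Finsupp.single j 1 →
      ∃ (x y : ↥(BM a b ∪ BN b c d)) (k l : Fin n),
        Finsupp.single x 1 + Finsupp.single y 1 ≤ T ∧
        (x : Fin n →₀ ℕ) = Finsupp.single i 1 + Finsupp.single k 1 ∧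
        (y : Fin n →₀ ℕ) = Finsupp.single j 1 + Finsupp.single l 1 := by
    intro i j hij
    refine exists_pair_of_le_fiberMap _ T (hij ▸ hle) hquad fun x hx hxm => ?_
    exact MrlexGt.irrefl h2 _ ((hxm.trans hij.symm) ▸ hmin x hx)
  have hswap : ∀ {x y : ↥(BM a b ∪ BN b c d)} {i j k l : Fin n},
      Finsupp.single x 1 + Finsupp.single y 1 ≤ T →
      (m : Fin n →₀ ℕ) = Finsupp.single i 1 + Finsupp.single j 1 →
      (x : Fin n →₀ ℕ) = Finsupp.single i 1 + Finsupp.single k 1 →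
      (y : Fin n →₀ ℕ) = Finsupp.single j 1 + Finsupp.single l 1 →
      Finsupp.single k 1 + Finsupp.single l 1 ∉ BM a b ∪ BN b c d := by
    intro x y i j k l hxy hm hx hy hmem
    have hxT : x ∈ T.support := by
      have := hxy x
      simp only [Finsupp.add_apply, Finsupp.single_eq_same] at this
      rw [Finsupp.mem_support_iff]; omega
    have hyT : y ∈ T.support := by
      have := hxy y
      simp only [Finsupp.add_apply, Finsupp.single_eq_same] at this
      rw [Finsupp.mem_support_iff]; omega
    refine hT x y ⟨_, hmem⟩ m hxy ?_ (hmin x hxT) (hmin y hyT)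
    simp only [hx, hy, hm]
    abel
  have hsupp : ∀ {x y : ↥(BM a b ∪ BN b c d)}, Finsupp.single x 1 + Finsupp.single y 1 ≤ T →
      x ∈ T.support ∧ y ∈ T.support := by
    intro x y hxy
    have hx := hxy x
    have hy := hxy y
    simp only [Finsupp.add_apply, Finsupp.single_eq_same] at hx hy
    rw [Finsupp.mem_support_iff, Finsupp.mem_support_iff]; omega
  rcases m.2 with hmM | hmN
  · obtain ⟨i, j, hij, hia, hjb, hm⟩ := id hmM
    obtain ⟨x, y, k, l, hxy, hx, hy⟩ := hpair hm
    obtain ⟨hxT, hyT⟩ := hsupp hxy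
    have hno := hswap hxy hm hx hy
    have hxM : (x : Fin n →₀ ℕ) ∈ BM a b → k < j := fun h => by
      have := (hmin x hxT).rlexGt h2 h
      rwa [hx, hm, rlexGt_add_single] at this
    have hyM : (y : Fin n →₀ ℕ) ∈ BM a b → l < i := fun h => by
      have := (hmin y hyT).rlexGt h2 h
      rwa [hy, hm, add_comm (Finsupp.single i 1), rlexGt_add_single] at this
    have hxN : (x : Fin n →₀ ℕ) ∈ BN b c d → i ≤ c ∧ b < k ∧ k ≤ d := fun h => by
      obtain ⟨k', hk', h'⟩ := exists_eq_single_add_single_of_mem_BN h (i := i) (by simp [hx])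
      have : k' = k := by
        rw [hx, add_right_inj] at hk'
        exact ((Finsupp.single_left_inj one_ne_zero).1 hk').symm
      subst this
      rcases h' with h' | h'
      · exact h'
      · exact absurd (hia.trans h2) (not_le.2 h'.2.1)
    have hyN : (y : Fin n →₀ ℕ) ∈ BN b c d → j ≤ c ∧ b < l ∧ l ≤ d := fun h => by
      obtain ⟨l', hl', h'⟩ := exists_eq_single_add_single_of_mem_BN h (i := j) (by simp [hy])
      have : l' = l := by
        rw [hy, add_right_inj] at hl'
        exact ((Finsupp.single_left_inj one_ne_zero).1 hl').symm
      subst this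
      rcases h' with h' | h'
      · exact h'
      · exact absurd hjb (not_le.2 h'.2.1)
    rcases x.2 with hx' | hx' <;> rcases y.2 with hy' | hy'
    · have h3 := hxM hx'
      have h4 := hyM hy'
      exact hno (Or.inl (single_add_single_mem_BM (h3.le.trans hjb)
        ((h4.le.trans hia).trans h2) (Or.inr (h4.le.trans hia))))
    · have h3 := hxM hx'
      have h4 := hyN hy'
      exact hno (Or.inr ⟨k, l, h3.le.trans h4.1, h4.2.1, h4.2.2, rfl⟩)
    · have h3 := hxN hx'
      have h4 := hyM hy'
      exact hno (Or.inr ⟨l, k, h4.le.trans h3.1, h3.2.1, h3.2.2, add_comm _ _⟩)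
    · have h3 := hxN hx'
      have h4 := hyN hy'
      obtain ⟨w, hwT, hwM⟩ := hM hmM
      have hwm := (hmin w hwT).rlexGt h2 hwM
      have hxw : x ≠ w := fun h => notMem_BM_of_mem_BN h2 hx' (h ▸ hwM)
      have hyw : y ≠ w := fun h => notMem_BM_of_mem_BN h2 hy' (h ▸ hwM)
      obtain ⟨p, q, hpq, hpa, hqb, hw⟩ := id hwM
      have hqj : q ≤ j := by
        rw [hw, hm] at hwm
        exact hwm.le_of_pair hij
      rcases hqj.eq_or_lt with rfl | hqj
      · have hpi : p < i := by
          rwa [hw, hm, add_comm (Finsupp.single p 1), add_comm (Finsupp.single i 1),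
            rlexGt_add_single] at hwm
        exact hswap (single_add_single_le hxT hwT hxw) hm hx (hw.trans (add_comm _ _))
          (Or.inr ⟨p, k, hpi.le.trans h3.1, h3.2.1, h3.2.2, add_comm _ _⟩)
      · have hmem : Finsupp.single q 1 + Finsupp.single j 1 ∈ BM a b :=
          single_add_single_mem_BM hqb hjb (Or.inl (hqj.le.trans (h4.1.trans h1.le)))
        have hmem' : Finsupp.single p 1 + Finsupp.single l 1 ∈ BN b c d :=
          ⟨p, l, (hpq.trans hqj.le).trans h4.1, h4.2.1, h4.2.2, rfl⟩
        refine hT y w ⟨_, Or.inr hmem'⟩ ⟨_, Or.inl hmem⟩ (single_add_single_le hyT hwT hyw) ?_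
          (Or.inl ⟨hy', hmem⟩) (Or.inr (Or.inl ⟨hwM, hmem, ?_⟩))
        · simp only [hy, hw]
          abel
        · simp only [hw]
          rw [add_comm (Finsupp.single p 1), rlexGt_add_single]
          exact hpq.trans_lt hqj
  · obtain ⟨i, j, hi, hj, hjd, hm⟩ := id hmN
    obtain ⟨x, y, k, l, hxy, hx, hy⟩ := hpair hm
    obtain ⟨hxT, hyT⟩ := hsupp hxy
    have hx' := (hmin x hxT).mem_BN h2 hmN
    have hy' := (hmin y hyT).mem_BN h2 hmN
    obtain ⟨k', hk', hk⟩ := exists_eq_single_add_single_of_mem_BN hx' (i := i) (by simp [hx])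
    obtain ⟨l', hl', hl⟩ := exists_eq_single_add_single_of_mem_BN hy' (i := j) (by simp [hy])
    have hcb : c < b := h1.trans_le h2
    have hk := hk.resolve_right fun h => absurd (hi.trans hcb.le) (not_le.2 h.2.1)
    have hl := hl.resolve_left fun h => absurd (h.1.trans hcb.le) (not_le.2 hj)
    exact hswap hxy hm hk' hl' (Or.inr ⟨l', k', hl.1, hk.2.1, hk.2.2, add_comm _ _⟩)

/-- The number of variables `x_k` with `k ≤ b` minus the number of those with `b < k`. -/
noncomputable def signedDegree (b : Fin n) : (Fin n →₀ ℕ) →ₗ[ℕ] ℤ :=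
  Finsupp.linearCombination ℕ fun k => if k ≤ b then (1 : ℤ) else -1

theorem signedDegree_of_mem_BM (h2 : a ≤ b) {x : Fin n →₀ ℕ} (hx : x ∈ BM a b) :
    signedDegree b x = 2 := by
  obtain ⟨i, j, -, hi, hj, rfl⟩ := hx
  simp [signedDegree, hi.trans h2, hj]

theorem signedDegree_of_mem_BN (hcb : c ≤ b) {x : Fin n →₀ ℕ} (hx : x ∈ BN b c d) :
    signedDegree b x = 0 := by
  obtain ⟨i, j, hi, hj, -, rfl⟩ := hx
  simp [signedDegree, hi.trans hcb, hj.not_ge]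

/-- Two monomials in the same fiber either both have or both lack a factor from `BM`. -/
theorem exists_mem_BM_of_fiberMap_eq (hcb : c ≤ b) (h2 : a ≤ b)
    {T T' : ↥(BM a b ∪ BN b c d) →₀ ℕ}
    (h : fiberMap (fun w : ↥(BM a b ∪ BN b c d) => (w : Fin n →₀ ℕ)) T =
      fiberMap (fun w : ↥(BM a b ∪ BN b c d) => (w : Fin n →₀ ℕ)) T')
    {m : ↥(BM a b ∪ BN b c d)} (hm : m ∈ T'.support) (hmM : (m : Fin n →₀ ℕ) ∈ BM a b) :
    ∃ w ∈ T.support, (w : Fin n →₀ ℕ) ∈ BM a b := by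
  by_contra! hc
  have hs := congrArg (signedDegree b) h
  simp only [fiberMap, Finsupp.sum, map_sum, map_nsmul] at hs
  rw [Finset.sum_eq_zero] at hs
  · refine hs.not_lt (Finset.sum_pos' (fun w _ => ?_) ⟨m, hm, ?_⟩)
    · rcases w.2 with hw | hw
      · rw [signedDegree_of_mem_BM h2 hw]; positivity
      · rw [signedDegree_of_mem_BN hcb hw]; simp
    · rw [signedDegree_of_mem_BM h2 hmM]
      have := Nat.pos_of_ne_zero (Finsupp.mem_support_iff.1 hm)
      positivity
  · intro w hw
    rw [signedDegree_of_mem_BN hcb (w.2.resolve_left (hc w hw)), smul_zero]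

theorem not_forall_mrlexGt_of_fiberMap_eq (h1 : c < a) (h2 : a ≤ b)
    {T T' : ↥(BM a b ∪ BN b c d) →₀ ℕ} (hT : IsG2Irreducible T)
    (h : fiberMap (fun w : ↥(BM a b ∪ BN b c d) => (w : Fin n →₀ ℕ)) T =
      fiberMap (fun w : ↥(BM a b ∪ BN b c d) => (w : Fin n →₀ ℕ)) T')
    {m : ↥(BM a b ∪ BN b c d)} (hm : m ∈ T'.support) :
    ¬ ∀ u ∈ T.support, MrlexGt a b c d u m := by
  refine hT.not_forall_mrlexGt h1 h2 m ?_
    (exists_mem_BM_of_fiberMap_eq (h1.le.trans h2) h2 h hm)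
  have hmT : Finsupp.single m 1 ≤ T' := by
    rw [Finsupp.single_le_iff]
    exact Nat.one_le_iff_ne_zero.2 (Finsupp.mem_support_iff.1 hm)
  obtain ⟨R, rfl⟩ := exists_add_of_le hmT
  rw [h, fiberMap_eq_linearCombination, map_add, Finsupp.linearCombination_single, one_smul]
  exact le_self_add

theorem IsG2Irreducible.eq_of_fiberMap_eq (h1 : c < a) (h2 : a ≤ b)
    {T T' : ↥(BM a b ∪ BN b c d) →₀ ℕ} (hT : IsG2Irreducible T) (hT' : IsG2Irreducible T')
    (h : fiberMap (fun w : ↥(BM a b ∪ BN b c d) => (w : Fin n →₀ ℕ)) T =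
      fiberMap (fun w : ↥(BM a b ∪ BN b c d) => (w : Fin n →₀ ℕ)) T') : T = T' := by
  classical
  by_contra hne
  have hsub : fiberMap (fun w : ↥(BM a b ∪ BN b c d) => (w : Fin n →₀ ℕ)) (T - T') =
      fiberMap (fun w : ↥(BM a b ∪ BN b c d) => (w : Fin n →₀ ℕ)) (T' - T) := by
    have e : T - T' + T' = T' - T + T := by
      ext x
      simp only [Finsupp.add_apply, Finsupp.tsub_apply]
      omega
    have e' := congrArg (Finsupp.linearCombination ℕ
      fun w : ↥(BM a b ∪ BN b c d) => (w : Fin n →₀ ℕ)) e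
    rw [map_add, map_add] at e'
    simp only [fiberMap_eq_linearCombination] at h ⊢
    rw [h] at e'
    exact add_right_cancel e'
  have hI := hT.mono (tsub_le_self (b := T'))
  have hI' := hT'.mono (tsub_le_self (b := T))
  have hnonempty : ((T - T').support ∪ (T' - T).support).Nonempty := by
    obtain ⟨x, hx⟩ := Finsupp.ne_iff.1 hne
    refine ⟨x, ?_⟩
    simp only [Finset.mem_union, Finsupp.mem_support_iff, Finsupp.tsub_apply]
    omega
  obtain ⟨r, hr⟩ := exists_rank (c := c) (d := d) h2
  obtain ⟨m, hm, hmax⟩ := Finset.exists_max_image _ r hnonempty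
  have hgt : ∀ u ∈ (T - T').support ∪ (T' - T).support, u ≠ m → MrlexGt a b c d u m :=
    fun u hu hum => (MrlexGt.total hum).resolve_right fun h' =>
      absurd (hr _ _ h') (not_lt.2 (hmax u hu))
  rcases Finset.mem_union.1 hm with hm | hm
  · refine not_forall_mrlexGt_of_fiberMap_eq h1 h2 hI' hsub.symm hm fun u hu =>
      hgt u (Finset.mem_union_right _ hu) ?_
    rintro rfl
    simp only [Finsupp.mem_support_iff, Finsupp.tsub_apply] at hm hu
    omega
  · refine not_forall_mrlexGt_of_fiberMap_eq h1 h2 hI hsub hm fun u hu =>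
      hgt u (Finset.mem_union_left _ hu) ?_
    rintro rfl
    simp only [Finsupp.mem_support_iff, Finsupp.tsub_apply] at hm hu
    omega

end Generators

/-- For the strongly stable ideal `I = B(x_a x_b, x_c x_d)` with
`c < a ≤ b < d` and the marked collection `G₂`, every fiber graph `Γ_μ(I)` with respect
to `G₂` is either empty or has a unique sink. -/
theorem G2_fiberGraph_unique_sink {n : ℕ} (a b c d : Fin n)
    (h1 : c < a) (h2 : a ≤ b) (h3 : b < d) :
    ∀ μ : Fin n →₀ ℕ,
      (∀ T : ↥(BM a b ∪ BN b c d) →₀ ℕ,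
        fiberMap (fun w : ↥(BM a b ∪ BN b c d) => (w : Fin n →₀ ℕ)) T ≠ μ) ∨
      (∃! T : ↥(BM a b ∪ BN b c d) →₀ ℕ,
        IsFiberSink (G2 a b c d) (fun w : ↥(BM a b ∪ BN b c d) => (w : Fin n →₀ ℕ)) μ T) := by
  intro μ
  by_cases hμ : ∀ T : ↥(BM a b ∪ BN b c d) →₀ ℕ,
      fiberMap (fun w : ↥(BM a b ∪ BN b c d) => (w : Fin n →₀ ℕ)) T ≠ μ
  · exact Or.inl hμ
  · push Not at hμ
    obtain ⟨T, rfl⟩ := hμ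
    obtain ⟨T', hT', hirr⟩ := exists_isG2Irreducible h2 T
    refine Or.inr ⟨T', (isFiberSink_iff _ _).2 ⟨hT', hirr⟩, fun S hS => ?_⟩
    obtain ⟨hS, hSirr⟩ := (isFiberSink_iff _ _).1 hS
    exact hSirr.eq_of_fiberMap_eq h1 h2 hirr (hS.trans hT'.symm)
end
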